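/- Let Q be a finite simple quandle whose cardinality is not a prime power, and let G = Inn Q be its inner automorphism group. Then G has a unique minimal normal subgroup D, this subgroup D equals the commutator subgroup [G,G], and D is isomorphic to a direct product T₁ × ⋯ × T_k (for some k ≥ 1) in which each factor T_i is isomorphic to one fixed finite nonabelian simple group T. -/

import Mathlib

universe u v

/-- A quandle: a set with a binary operation `◃` such that every right
translation `x ↦ x ◃ a` is bijective, the operation is right self-distributive,
and every element is idempotent. -/
class Quandle' (Q : Type u) where
  act : Q → Q → Q
  act_bijective : ∀ a : Q, Function.Bijective fun x => act x a
  act_distrib : ∀ a b c : Q, act (act a b) c = act (act a c) (act b c)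
  act_self : ∀ a : Q, act a a = a

infixl:65 " ◃ " => Quandle'.act

namespace Quandle'

/-- The right translation by `a`, as a permutation of the quandle. -/
noncomputable def rho {Q : Type u} [Quandle' Q] (a : Q) : Equiv.Perm Q :=
  Equiv.ofBijective _ (act_bijective a)

/-- The inner automorphism group of a quandle: the subgroup of the symmetric
group generated by the right translations. -/
noncomputable def Inn (Q : Type u) [Quandle' Q] : Subgroup (Equiv.Perm Q) :=
  Subgroup.closure (Set.range (rho : Q → Equiv.Perm Q))

/-- A quandle is connected if its inner automorphism group acts transitively. -/
def IsConnected (Q : Type u) [Quandle' Q] : Prop :=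
  ∀ x y : Q, ∃ g ∈ Inn Q, g x = y

/-- Quandle homomorphisms. -/
def IsHom {Q : Type u} {R : Type v} [Quandle' Q] [Quandle' R] (f : Q → R) : Prop :=
  ∀ a b : Q, f (a ◃ b) = f a ◃ f b

/-- A quandle is simple if it has more than one element and every quandle
homomorphism out of it is either injective or constant. -/
def IsSimple (Q : Type u) [Quandle' Q] : Prop :=
  Nontrivial Q ∧ ∀ (R : Type u) [Quandle' R] (f : Q → R), IsHom f →
    Function.Injective f ∨ ∀ a b : Q, f a = f b

/-- A block for the action of the inner automorphism group. -/
noncomputable def IsBlock (Q : Type u) [Quandle' Q] (B : Set Q) : Prop :=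
  ∀ g ∈ Inn Q, ⇑g '' B = B ∨ Disjoint (⇑g '' B) B

/-- A connected quandle is primitive if the action of its inner automorphism
group preserves no nontrivial partition into blocks. -/
noncomputable def IsPrimitive (Q : Type u) [Quandle' Q] : Prop :=
  IsConnected Q ∧ ∀ B : Set Q, IsBlock Q B → B.Subsingleton ∨ B = Set.univ

end Quandle'

open Quandle'

/-- The conjugacy class of transpositions in the symmetric group `S₅`. -/
abbrev Transposition5 : Type := {σ : Equiv.Perm (Fin 5) // σ.IsSwap}

/-- The conjugation quandle structure `a ◃ b = b⁻¹ * a * b` on the class of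
transpositions of `S₅`. -/
instance : Quandle' Transposition5 where
  act a b := ⟨b.1⁻¹ * a.1 * b.1, by
    obtain ⟨x, y, hxy, ha⟩ := a.2
    refine ⟨b.1⁻¹ x, b.1⁻¹ y, fun h => hxy (b.1⁻¹.injective h), ?_⟩
    rw [ha, Equiv.swap_apply_apply]
    group⟩
  act_bijective a := by
    constructor
    · intro x y h
      have := Subtype.ext_iff.mp h
      simp only [mul_left_cancel_iff, mul_right_cancel_iff] at this
      exact Subtype.ext this
    · intro y
      refine ⟨⟨a.1 * y.1 * a.1⁻¹, ?_⟩, Subtype.ext (by group)⟩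
      obtain ⟨x, z, hxz, hy⟩ := y.2
      refine ⟨a.1 x, a.1 z, fun h => hxz (a.1.injective h), ?_⟩
      rw [hy, Equiv.swap_apply_apply]
  act_distrib a b c := Subtype.ext (by simp only []; group)
  act_self a := Subtype.ext (by simp only []; group)

/-- A minimal normal subgroup: a nontrivial normal subgroup containing no
nontrivial normal subgroup of the ambient group properly. -/
def IsMinimalNormal {G : Type u} [Group G] (D : Subgroup G) : Prop :=
  D.Normal ∧ D ≠ ⊥ ∧ ∀ N : Subgroup G, N.Normal → N ≠ ⊥ → N ≤ D → N = D

section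

variable {G : Type u} [Group G]

/-- A finite commutative characteristically simple group is a `p`-group. -/
theorem exists_isPGroup_of_commute [Finite G] [Nontrivial G]
    (hchar : ∀ K : Subgroup G, K.Characteristic → K = ⊥ ∨ K = ⊤)
    (hcomm : ∀ a b : G, a * b = b * a) : ∃ p : ℕ, p.Prime ∧ IsPGroup p G := by
  let : CommGroup G := { ‹Group G› with mul_comm := hcomm }
  obtain ⟨p, hp, hdvd⟩ := Nat.exists_prime_and_dvd (Finite.one_lt_card (α := G)).ne'
  have : Fact p.Prime := ⟨hp⟩
  obtain ⟨x, hx⟩ := exists_prime_orderOf_dvd_card' p hdvd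
  let K : Subgroup G := (powMonoidHom p : G →* G).ker
  have hK : K.Characteristic := by
    refine ⟨fun φ => ?_⟩
    ext y
    change φ y ^ p = 1 ↔ y ^ p = 1
    rw [← map_pow, map_eq_one_iff φ φ.injective]
  have hxK : x ∈ K := by
    change x ^ p = 1
    rw [← hx, pow_orderOf_eq_one]
  rcases hchar K hK with h | h
  · rw [h, Subgroup.mem_bot] at hxK
    rw [hxK, orderOf_one] at hx
    exact absurd hx.symm hp.ne_one
  · refine ⟨p, hp, fun g => ⟨1, ?_⟩⟩
    have : g ∈ K := h ▸ Subgroup.mem_top g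
    rw [pow_one]
    exact this

/-- A minimal normal subgroup which together with its centralizer generates the whole group is
simple. -/
theorem isSimpleGroup_of_sup_centralizer_eq_top (M : Subgroup G) (hM : IsMinimalNormal M)
    (h : M ⊔ Subgroup.centralizer (M : Set G) = ⊤) : IsSimpleGroup M := by
  have := hM.1
  have : Nontrivial M := (Subgroup.nontrivial_iff_ne_bot M).mpr hM.2.1
  refine ⟨fun H hH => ?_⟩
  have hnormal : (H.map M.subtype).Normal := by
    rw [← Subgroup.normalizer_eq_top_iff, eq_top_iff, ← h, sup_le_iff]
    constructor
    · have := Subgroup.le_normalizer_map (H := H) M.subtype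
      rwa [Subgroup.normalizer_eq_top_iff.mpr hH, ← MonoidHom.range_eq_map, M.range_subtype] at this
    · intro x hx
      rw [Subgroup.mem_normalizer_iff_map_conj_eq, Subgroup.map_map]
      congr 1
      ext m
      change x * m * x⁻¹ = m
      rw [← hx m m.2, mul_inv_cancel_right]
  by_cases hbot : H.map M.subtype = ⊥
  · exact Or.inl ((Subgroup.map_eq_bot_iff_of_injective _ M.subtype_injective).mp hbot)
  · right
    have := hM.2.2 _ hnormal hbot (Subgroup.map_subtype_le H)
    exact Subgroup.map_injective M.subtype_injective
      (this.trans (by rw [← MonoidHom.range_eq_map, M.range_subtype]))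

theorem exists_isMinimalNormal [Finite G] [Nontrivial G] : ∃ M : Subgroup G, IsMinimalNormal M := by
  obtain ⟨M, hM⟩ := (Set.toFinite {N : Subgroup G | N.Normal ∧ N ≠ ⊥}).exists_minimal
    ⟨⊤, inferInstance, top_ne_bot⟩
  exact ⟨M, hM.prop.1, hM.prop.2, fun N hN hb hle => hM.eq_of_le ⟨hN, hb⟩ hle⟩

theorem IsMinimalNormal.map_equiv {M : Subgroup G} (hM : IsMinimalNormal M) (φ : G ≃* G) :
    IsMinimalNormal (M.map φ.toMonoidHom) := by
  refine ⟨hM.1.map _ φ.surjective, fun h => hM.2.1 ?_, fun N hN hb hle => ?_⟩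
  · exact (Subgroup.map_eq_bot_iff_of_injective _ φ.injective).mp h
  · have h := hM.2.2 (N.map φ.symm.toMonoidHom) (hN.map _ φ.symm.surjective)
      (fun h => hb ((Subgroup.map_eq_bot_iff_of_injective _ φ.symm.injective).mp h)) ?_
    · rw [← h, Subgroup.map_map]
      convert! (Subgroup.map_id N).symm
      ext x
      exact φ.apply_symm_apply x
    · rw [Subgroup.map_le_iff_le_comap]
      intro x hx
      obtain ⟨y, hy, rfl⟩ := hle hx
      change φ.symm (φ y) ∈ M
      rwa [φ.symm_apply_apply]

theorem IsMinimalNormal.disjoint {M N : Subgroup G} (hM : IsMinimalNormal M)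
    (hN : IsMinimalNormal N) (h : M ≠ N) : Disjoint M N := by
  have := hM.1
  have := hN.1
  rw [disjoint_iff]
  by_contra hb
  exact h ((hM.2.2 (M ⊓ N) inferInstance hb inf_le_left).symm.trans
    (hN.2.2 (M ⊓ N) inferInstance hb inf_le_right))

/-- A finite nonabelian characteristically simple group is a power of a nonabelian simple group. -/
theorem exists_mulEquiv_pi_of_characteristicallySimple [Finite G]
    (hchar : ∀ K : Subgroup G, K.Characteristic → K = ⊥ ∨ K = ⊤)
    (hcomm : ¬ ∀ a b : G, a * b = b * a) :
    ∃ (T : Type u) (_ : Group T) (_ : Finite T), IsSimpleGroup T ∧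
      (¬ ∀ a b : T, a * b = b * a) ∧ ∃ k : ℕ, 1 ≤ k ∧ Nonempty (G ≃* (Fin k → T)) := by
  classical
  have : Nontrivial G := by
    by_contra h
    rw [not_nontrivial_iff_subsingleton] at h
    exact hcomm fun a b => Subsingleton.elim _ _
  have hcenter : Subgroup.center G = ⊥ :=
    (hchar _ inferInstance).resolve_right fun h => hcomm fun a b =>
      (Subgroup.mem_center_iff.mp (h ▸ Subgroup.mem_top b) a)
  obtain ⟨M, hM⟩ := exists_isMinimalNormal (G := G)
  let ι := Set.range fun φ : G ≃* G => M.map φ.toMonoidHom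
  have : Fintype ι := Fintype.ofFinite ι
  let H : ι → Subgroup G := Subtype.val
  have hmin (i : ι) : IsMinimalNormal (H i) := by
    obtain ⟨_, φ, rfl⟩ := i
    exact hM.map_equiv φ
  have hC : Pairwise fun i j : ι => ∀ x y : G, x ∈ H i → y ∈ H j → Commute x y :=
    fun i j hij x y hx hy => Subgroup.commute_of_normal_of_disjoint _ _ (hmin i).1 (hmin j).1
      ((hmin i).disjoint (hmin j) (Subtype.val_injective.ne hij)) x y hx hy
  have hcent (i : ι) : ⨆ (j) (_ : j ≠ i), H j ≤ Subgroup.centralizer (H i : Set G) :=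
    iSup₂_le fun j hj y hy x hx => hC hj.symm x y hx hy
  have htop : ⨆ i, H i = ⊤ := by
    refine (hchar _ (Subgroup.characteristic_iff_map_le.mpr ?_)).resolve_left fun h => ?_
    · intro φ
      rw [Subgroup.map_iSup]
      refine iSup_le ?_
      rintro ⟨_, ψ, rfl⟩
      exact le_trans (Subgroup.map_map _ _ _).le (le_iSup H ⟨_, ψ.trans φ, rfl⟩)
    · exact (hmin ⟨_, MulEquiv.refl G, rfl⟩).2.1 (eq_bot_iff.mpr (h ▸ le_iSup H _))
  have hsup (i : ι) : H i ⊔ ⨆ (j) (_ : j ≠ i), H j = ⊤ := by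
    rw [eq_top_iff, ← htop]
    refine iSup_le fun j => ?_
    by_cases hj : j = i
    · exact hj ▸ le_sup_left
    · exact le_sup_of_le_right (le_iSup₂_of_le j hj le_rfl)
  have hind : iSupIndep H := fun i => by
    rw [disjoint_iff, eq_bot_iff, ← hcenter, ← Subgroup.centralizer_univ, ← Subgroup.coe_top,
      ← hsup i, Subgroup.le_centralizer_iff, sup_le_iff]
    exact ⟨Subgroup.le_centralizer_iff.mp (inf_le_right.trans (hcent i)),
      Subgroup.le_centralizer_iff.mp (inf_le_left.trans (Subgroup.le_centralizer_iff.mp (hcent i)))⟩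
  have hbij : Function.Bijective (Subgroup.noncommPiCoprod hC) :=
    ⟨Subgroup.injective_noncommPiCoprod_of_iSupIndep hind, MonoidHom.range_eq_top.mp
      (Subgroup.noncommPiCoprod_range.trans htop)⟩
  have e (i : ι) : Nonempty (H i ≃* M) := by
    obtain ⟨_, φ, rfl⟩ := i
    exact ⟨(M.equivMapOfInjective φ.toMonoidHom φ.injective).symm⟩
  let i₀ : ι := ⟨_, MulEquiv.refl G, rfl⟩
  let E : G ≃* (Fin (Fintype.card ι) → M) := (MulEquiv.ofBijective _ hbij).symm.trans
    ((MulEquiv.piCongrRight fun i => (e i).some).trans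
      (MulEquiv.arrowCongr (Fintype.equivFin ι) (MulEquiv.refl M)))
  have hM0 : H i₀ = M := Subgroup.map_id M
  refine ⟨M, inferInstance, inferInstance, ?_, fun h => hcomm fun a b => ?_,
    Fintype.card ι, Fintype.card_pos_iff.mpr ⟨i₀⟩, ⟨E⟩⟩
  · refine isSimpleGroup_of_sup_centralizer_eq_top M hM (eq_top_iff.mpr ?_)
    have h := hcent i₀
    rw [← hsup i₀, hM0]
    rw [hM0] at h
    exact sup_le_sup_left h _
  · apply E.injective
    rw [map_mul, map_mul]
    exact funext fun _ => h _ _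

theorem IsMinimalNormal.eq_bot_or_eq_top_of_characteristic {D : Subgroup G}
    (hD : IsMinimalNormal D) (K : Subgroup D) (hK : K.Characteristic) : K = ⊥ ∨ K = ⊤ := by
  have := hD.1
  by_cases hbot : K.map D.subtype = ⊥
  · exact Or.inl ((Subgroup.map_eq_bot_iff_of_injective _ D.subtype_injective).mp hbot)
  · right
    have := hD.2.2 _ inferInstance hbot (Subgroup.map_subtype_le K)
    exact Subgroup.map_injective D.subtype_injective
      (this.trans (by rw [← MonoidHom.range_eq_map, D.range_subtype]))

end

namespace Quandle'

section

variable {Q : Type u} [Quandle' Q]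

theorem rho_mem_Inn (a : Q) : rho a ∈ Inn Q := Subgroup.subset_closure ⟨a, rfl⟩

/-- The right translation by `a`, as an inner automorphism. -/
noncomputable def innRho (a : Q) : Inn Q := ⟨rho a, rho_mem_Inn a⟩

theorem innRho_smul (a x : Q) : innRho a • x = x ◃ a := rfl

theorem Inn_smul_act (g : Inn Q) (x a : Q) : g • (x ◃ a) = (g • x) ◃ (g • a) := by
  obtain ⟨g, hg⟩ := g
  change g (x ◃ a) = g x ◃ g a
  induction hg using Subgroup.closure_induction generalizing x a with
  | mem g hg =>
    obtain ⟨c, rfl⟩ := hg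
    exact act_distrib x a c
  | one => rfl
  | mul g h _ _ ihg ihh => simp only [Equiv.Perm.mul_apply, ihg, ihh]
  | inv g _ ih =>
    apply g.injective
    rw [ih]
    simp

theorem innRho_smul_eq_conj (g : Inn Q) (a : Q) : innRho (g • a) = g * innRho a * g⁻¹ := by
  ext x
  change x ◃ (g • a) = g • ((g⁻¹ • x) ◃ a)
  rw [Inn_smul_act, smul_inv_smul]

theorem orbitRel_act (N : Subgroup (Inn Q)) [N.Normal] {a a' b b' : Q}
    (ha : MulAction.orbitRel N Q a a') (hb : MulAction.orbitRel N Q b b') :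
    MulAction.orbitRel N Q (a ◃ b) (a' ◃ b') := by
  obtain ⟨n, rfl⟩ := ha
  obtain ⟨m, rfl⟩ := hb
  refine ⟨⟨m * (innRho b' * (m⁻¹ * n) * (innRho b')⁻¹), N.mul_mem m.2
    (Subgroup.Normal.conj_mem ‹_› _ (N.mul_mem (N.inv_mem m.2) n.2) _)⟩, ?_⟩
  change ((m : Inn Q) * (innRho b' * ((m : Inn Q)⁻¹ * n) * (innRho b')⁻¹)) • (a' ◃ b') =
    ((n : Inn Q) • a') ◃ ((m : Inn Q) • b')
  rw [← innRho_smul b' a', ← innRho_smul, innRho_smul_eq_conj]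
  simp only [mul_smul, inv_smul_smul]

/-- The quotient of a finite quandle by the orbits of a normal subgroup of its inner
automorphism group. -/
noncomputable abbrev orbitQuotient [Finite Q] (N : Subgroup (Inn Q)) [N.Normal] :
    Quandle' (MulAction.orbitRel.Quotient N Q) where
  act := Quotient.map₂ (· ◃ ·) fun _ _ ha _ _ hb => orbitRel_act N ha hb
  act_bijective := by
    rintro ⟨a⟩
    refine Function.Surjective.bijective_of_finite ?_
    rintro ⟨y⟩
    obtain ⟨x, hx⟩ := (act_bijective a).surjective y
    exact ⟨Quotient.mk _ x, congrArg _ hx⟩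
  act_distrib := by
    rintro ⟨a⟩ ⟨b⟩ ⟨c⟩
    exact congrArg _ (act_distrib a b c)
  act_self := by
    rintro ⟨a⟩
    exact congrArg _ (act_self a)

theorem IsSimple.eq_bot_or_forall_exists_smul_eq [Finite Q] (hs : IsSimple Q)
    (N : Subgroup (Inn Q)) [hN : N.Normal] : N = ⊥ ∨ ∀ x y : Q, ∃ n ∈ N, n • x = y := by
  let := orbitQuotient N
  rcases hs.2 (MulAction.orbitRel.Quotient N Q) (Quotient.mk _) (fun _ _ => rfl) with h | h
  · left
    rw [eq_bot_iff]
    intro n hn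
    rw [Subgroup.mem_bot]
    ext x
    exact h (Quotient.sound (s := MulAction.orbitRel N Q) ⟨⟨n, hn⟩, rfl⟩)
  · right
    intro x y
    obtain ⟨n, hn⟩ := Quotient.exact (h y x)
    exact ⟨n, n.2, hn⟩

/-- The trivial quandle structure. -/
abbrev trivialQuandle (R : Type u) : Quandle' R where
  act a _ := a
  act_bijective _ := Function.bijective_id
  act_distrib _ _ _ := rfl
  act_self _ := rfl

/-- The conjugation quandle of a group. -/
abbrev conjQuandle (G : Type u) [Group G] : Quandle' G where
  act a b := b * a * b⁻¹
  act_bijective b := (MulAut.conj b).bijective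
  act_distrib a b c := by group
  act_self a := by group

theorem IsSimple.card_eq_two_of_act_eq (hs : IsSimple Q)
    (h : ∀ a b : Q, a ◃ b = a) : Nat.card Q = 2 := by
  classical
  obtain ⟨x, y, hxy⟩ := hs.1
  let := trivialQuandle (ULift.{u} Prop)
  rcases hs.2 (ULift.{u} Prop) (fun z => ⟨z = x⟩)
    (fun a b => congrArg _ (congrArg (· = x) (h a b))) with hf | hf
  · refine Nat.card_eq_two_iff.mpr ⟨x, y, hxy, ?_⟩
    refine Set.eq_univ_of_forall fun z => ?_
    by_cases hz : z = x
    · exact Or.inl hz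
    · refine Or.inr (hf (congrArg ULift.up ?_))
      simp [hz, hxy.symm]
  · have := congrArg ULift.down (hf x y)
    simp [hxy.symm] at this

theorem IsSimple.innRho_injective (hs : IsSimple Q) (hc : Nat.card Q ≠ 2) :
    Function.Injective (innRho : Q → Inn Q) := by
  let := conjQuandle (Inn Q)
  refine (hs.2 (Inn Q) innRho fun a b => ?_).resolve_right fun h => hc ?_
  · exact innRho_smul_eq_conj (innRho b) a
  · refine hs.card_eq_two_of_act_eq fun a b => ?_
    rw [← innRho_smul, h b a, innRho_smul, act_self]

theorem commutator_Inn_le_of_forall_exists_smul_eq (N : Subgroup (Inn Q)) [N.Normal] (a : Q)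
    (h : ∀ x y : Q, ∃ n ∈ N, n • x = y) : commutator (Inn Q) ≤ N := by
  have key (g : Inn Q) : (g : Inn Q ⧸ N) ∈ Subgroup.zpowers (innRho a : Inn Q ⧸ N) := by
    obtain ⟨g, hg⟩ := g
    induction hg using Subgroup.closure_induction with
    | mem g hg =>
      obtain ⟨c, rfl⟩ := hg
      obtain ⟨n, hn, rfl⟩ := h a c
      change ((innRho (n • a) : Inn Q) : Inn Q ⧸ N) ∈ _
      rw [innRho_smul_eq_conj, QuotientGroup.mk_mul, QuotientGroup.mk_mul, QuotientGroup.mk_inv,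
        (QuotientGroup.eq_one_iff n).mpr hn]
      simp
    | one => exact one_mem _
    | mul g h _ _ ihg ihh => exact mul_mem ihg ihh
    | inv g _ ih => exact inv_mem ih
  rw [commutator_def, Subgroup.commutator_le]
  intro g _ h _
  rw [← QuotientGroup.eq_one_iff]
  obtain ⟨m, hm⟩ := key g
  obtain ⟨n, hn⟩ := key h
  refine (map_commutatorElement (QuotientGroup.mk' N) g h).trans ?_
  rw [commutatorElement_eq_one_iff_commute, QuotientGroup.mk'_apply, QuotientGroup.mk'_apply,
    ← hm, ← hn]
  exact (Commute.refl _).zpow_zpow m n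

theorem IsSimple.commutator_le [Finite Q] (hs : IsSimple Q) (N : Subgroup (Inn Q)) [N.Normal]
    (hN : N ≠ ⊥) : commutator (Inn Q) ≤ N := by
  obtain ⟨a, -⟩ := hs.1
  exact commutator_Inn_le_of_forall_exists_smul_eq N a
    ((hs.eq_bot_or_forall_exists_smul_eq N).resolve_left hN)

theorem IsSimple.commutator_ne_bot [Finite Q] (hs : IsSimple Q) (hc : Nat.card Q ≠ 2) :
    commutator (Inn Q) ≠ ⊥ := by
  intro hbot
  obtain ⟨x, y, hxy⟩ := hs.1
  have hinj := hs.innRho_injective hc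
  rcases hs.eq_bot_or_forall_exists_smul_eq (⊤ : Subgroup (Inn Q)) with h | h
  · have (g : Inn Q) : g = 1 := Subgroup.mem_bot.mp (h ▸ Subgroup.mem_top g)
    exact hxy (hinj ((this _).trans (this _).symm))
  · obtain ⟨g, -, rfl⟩ := h x y
    apply hxy
    apply hinj
    have hg := Subgroup.commutator_mem_commutator (Subgroup.mem_top g) (Subgroup.mem_top (innRho x))
    rw [← commutator_def, hbot, Subgroup.mem_bot, commutatorElement_eq_one_iff_mul_comm] at hg
    rw [innRho_smul_eq_conj, hg, mul_inv_cancel_right]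

theorem IsSimple.isMinimalNormal_commutator [Finite Q] (hs : IsSimple Q)
    (hc : Nat.card Q ≠ 2) : IsMinimalNormal (commutator (Inn Q)) :=
  ⟨inferInstance, hs.commutator_ne_bot hc,
    fun N _ hN hle => le_antisymm hle (hs.commutator_le N hN)⟩

theorem IsSimple.isPrimePow_card [Finite Q] (hs : IsSimple Q) (N : Subgroup (Inn Q)) [N.Normal]
    (hN : N ≠ ⊥) (p : ℕ) [hp : Fact p.Prime] (hpN : IsPGroup p N) : IsPrimePow (Nat.card Q) := by
  obtain ⟨x, -⟩ := hs.1
  have htrans := (hs.eq_bot_or_forall_exists_smul_eq N).resolve_left hN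
  have : MulAction.orbit N x = Set.univ := Set.eq_univ_of_forall fun y => by
    obtain ⟨n, hn, h⟩ := htrans x y
    exact ⟨⟨n, hn⟩, h⟩
  obtain ⟨n, hn⟩ := hpN.card_orbit x
  rw [this, Nat.card_univ] at hn
  have := hs.1
  have hn0 : n ≠ 0 := by
    rintro rfl
    exact Finite.one_lt_card.ne' (hn.trans (pow_zero p))
  exact hn ▸ hp.out.isPrimePow.pow hn0

end

end Quandle'

/-- For a finite simple quandle `Q` whose cardinality is not a prime power,
`G = Inn Q` has a unique minimal normal subgroup `D`; moreover `D` is the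
commutator subgroup `[G,G]` and is isomorphic to a direct power `T^k`
(`k ≥ 1`) of a fixed finite nonabelian simple group `T`. -/
theorem simple_quandle_inn_unique_minimal_normal (Q : Type) [Quandle' Q] [Fintype Q]
    (hs : IsSimple Q) (hnpp : ¬ IsPrimePow (Fintype.card Q)) :
    ∃ D : Subgroup (Inn Q), IsMinimalNormal D ∧
      (∀ N : Subgroup (Inn Q), IsMinimalNormal N → N = D) ∧
      D = commutator (Inn Q) ∧
      ∃ (T : Type) (_ : Group T) (_ : Finite T), IsSimpleGroup T ∧
        (¬ ∀ a b : T, a * b = b * a) ∧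
        ∃ k : ℕ, 1 ≤ k ∧ Nonempty (D ≃* (Fin k → T)) := by
  have hc : Nat.card Q ≠ 2 := fun h =>
    hnpp (Nat.card_eq_fintype_card (α := Q) ▸ h ▸ Nat.prime_two.isPrimePow)
  have hD := hs.isMinimalNormal_commutator hc
  refine ⟨commutator (Inn Q), hD, fun N hN => ?_, rfl, ?_⟩
  · have := hN.1
    exact (hN.2.2 _ hD.1 hD.2.1 (hs.commutator_le N hN.2.1)).symm
  · refine exists_mulEquiv_pi_of_characteristicallySimple hD.eq_bot_or_eq_top_of_characteristic
      fun hcomm => hnpp ?_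
    have := (Subgroup.nontrivial_iff_ne_bot _).mpr hD.2.1
    obtain ⟨p, hp, hpD⟩ :=
      exists_isPGroup_of_commute hD.eq_bot_or_eq_top_of_characteristic hcomm
    have : Fact p.Prime := ⟨hp⟩
    exact Nat.card_eq_fintype_card (α := Q) ▸ hs.isPrimePow_card _ hD.2.1 p hpD
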